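/- Consider the limit state-evolution (SE) recursion with initialization σ_r^0 = 1 for all r, and assume Γ ≥ 2W. Suppose ϑ^{−1}·R_alg < R_all < ϑ^{−1}·R_IT, set Δ = ϑ^{−1}·R_IT − R_all, let l* ∈ (0,1) satisfy l* − ln l* = ϑ·R_all/R_alg, let h* ∈ (0,1) satisfy ∫₀^{h*} F(t) dt − F(1)·h* = 2ϑΔ, and assume W > max{⌈1/l*⌉, ⌈1/h*⌉}. Set g = min{⌊h*·W⌋, ⌊l*·W⌋} (so g ≥ 1). Then for every k ≥ 0, ψ_c^k = ψ_{Γ−c+1}^k = 0 for all integers c with 1 ≤ c ≤ min{(k+1)·g, ⌈Γ/2⌉}; furthermore, with K = 1 + ⌈Γ/(2g)⌉, one has ψ_c^K = 0 for every c ∈ {1,…,Γ}. (Second bullet of Proposition 1.) -/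

import Mathlib

open MeasureTheory Finset

lemma F_scale (ρ₀ : Measure ℝ) [IsProbabilityMeasure ρ₀]
    (hsupp : ∃ K : Set ℝ, IsCompact K ∧ K ⊆ Set.Ioi 0 ∧ ρ₀ K = 1)
    (σ₀ : ℝ) (hσ₀ : 0 < σ₀)
    (F : ℝ → ℝ) (hF : ∀ x, F x = ∫ l, l / (l * x + σ₀ ^ 2) ∂ρ₀) :
    (∀ x, 0 ≤ x → 0 ≤ F x) ∧ 
    ∀ N a n w : ℝ, 0 ≤ N → N ≤ a → 0 < n → n ≤ w → F (a / w) / w ≤ F (N / n) / n := by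
  obtain ⟨K, hK, hK0, hK1⟩ := hsupp
  have hae : ∀ᵐ l ∂ρ₀, l ∈ K := by
    rw [← prob_compl_eq_zero_iff hK.measurableSet] at hK1
    exact hK1
  obtain ⟨M, hM⟩ := hK.isBounded.exists_norm_le
  have hs : 0 < σ₀ ^ 2 := by positivity
  have hint : ∀ x, 0 ≤ x → Integrable (fun l => l / (l * x + σ₀ ^ 2)) ρ₀ := by
    intro x hx
    refine Integrable.of_bound (C := M / σ₀ ^ 2) ?_ ?_
    · apply Measurable.aestronglyMeasurable
      fun_prop
    · filter_upwards [hae] with l hl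
      have h0 : 0 < l := hK0 hl
      have h1 := hM l hl
      rw [Real.norm_eq_abs, abs_of_pos h0] at h1
      rw [Real.norm_eq_abs, abs_of_nonneg (by positivity)]
      have : 0 ≤ l * x := by positivity
      gcongr
      · exact h0.le.trans h1
      · linarith
  constructor
  · intro x hx
    rw [hF]
    apply integral_nonneg_of_ae
    filter_upwards [hae] with l hl
    have h0 : 0 < l := hK0 hl
    show 0 ≤ l / (l * x + σ₀ ^ 2)
    positivity
  · intro N a n w hN hNa hn hnw
    have hw : 0 < w := hn.trans_le hnw
    have ha : 0 ≤ a := hN.trans hNa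
    rw [hF, hF, ← integral_div, ← integral_div]
    apply integral_mono_ae ((hint _ (by positivity)).div_const _)
      ((hint _ (by positivity)).div_const _)
    filter_upwards [hae] with l hl
    have h0 : 0 < l := hK0 hl
    have e : ∀ b v : ℝ, 0 < v → 0 ≤ b →
        l / (l * (b / v) + σ₀ ^ 2) / v = l / (l * b + σ₀ ^ 2 * v) := by
      intro b v hv hb
      rw [div_div]
      congr 1
      field_simp
    show l / (l * (a / w) + σ₀ ^ 2) / w ≤ l / (l * (N / n) + σ₀ ^ 2) / n
    rw [e _ _ hw ha, e _ _ hn hN]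
    gcongr

/-- comparison of a sum with a truncated integral -/
lemma trunc_sum (f : ℝ → ℝ) (W a : ℕ) (ha : a ≤ W)
    (hf : AntitoneOn f (Set.Icc (a:ℝ) W)) :
    (∫ x in (a:ℝ)..W, f x) + a * f W ≤ ∑ i ∈ range W, f (min (W:ℝ) (a + i)) := by
  have haW : (a:ℝ) ≤ W := by exact_mod_cast ha
  have h1 : AntitoneOn (fun x => f (min (W:ℝ) x)) (Set.Icc (a:ℝ) (a + W)) := by
    intro x hx y hy hxy
    apply hf
    · exact ⟨le_min haW hx.1, min_le_left _ _⟩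
    · exact ⟨le_min haW hy.1, min_le_left _ _⟩
    · exact min_le_min_left _ hxy
  have h2 := h1.integral_le_sum
  have hii : ∀ u v : ℝ, u ∈ Set.Icc (a:ℝ) (a+W) → v ∈ Set.Icc (a:ℝ) (a+W) →
      IntervalIntegrable (fun x => f (min (W:ℝ) x)) volume u v := by
    intro u v hu hv
    apply AntitoneOn.intervalIntegrable
    exact h1.mono (Set.uIcc_subset_Icc hu hv)
  have hWm : (W:ℝ) ∈ Set.Icc (a:ℝ) (a+W) := ⟨haW, by simp⟩
  rw [← intervalIntegral.integral_add_adjacent_intervals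
    (hii a W ⟨le_rfl, by simp⟩ hWm) (hii W (a+W) hWm ⟨by simp, le_rfl⟩)] at h2
  have e1 : (∫ x in (a:ℝ)..W, f (min (W:ℝ) x)) = ∫ x in (a:ℝ)..W, f x := by
    apply intervalIntegral.integral_congr
    intro x hx
    rw [Set.uIcc_of_le haW] at hx
    show f _ = f _
    rw [min_eq_right hx.2]
  have e2 : (∫ x in (W:ℝ)..(a+W), f (min (W:ℝ) x)) = a * f W := by
    have : (∫ x in (W:ℝ)..(a+W), f (min (W:ℝ) x)) = ∫ x in (W:ℝ)..(a+W), f W := by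
      apply intervalIntegral.integral_congr
      intro x hx
      rw [Set.uIcc_of_le (by simp)] at hx
      show f _ = f _
      rw [min_eq_left hx.1]
    rw [this]
    simp
  rw [e1, e2] at h2
  exact h2

lemma base_sum (W c : ℕ) (l : ℝ) (hc : 1 ≤ c) (hl1 : l < 1) (hcl : (c:ℝ) ≤ l * W) :
    l - Real.log l ≤ ∑ i ∈ range W, 1 / (min (W:ℝ) (c + i)) := by
  have hc0 : (0:ℝ) < c := by exact_mod_cast hc
  have hW0 : (0:ℝ) < W := by
    rcases Nat.eq_zero_or_pos W with h | h
    · subst h; simp at hcl; omega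
    · exact_mod_cast h
  have hl0 : 0 < l := by
    by_contra h
    push Not at h
    nlinarith
  have hcW' : (c:ℝ) ≤ W := by nlinarith
  have hcW : c ≤ W := by exact_mod_cast hcW'
  have h := trunc_sum (fun x => 1 / x) W c hcW (by
    intro x hx y hy hxy
    exact one_div_le_one_div_of_le (hc0.trans_le hx.1) hxy)
  refine le_trans ?_ h
  rw [integral_one_div_of_pos hc0 hW0]
  have hx : (c:ℝ) / W ≤ l := by rwa [div_le_iff₀ hW0]
  have hx0 : 0 < (c:ℝ) / W := by positivity
  have e : Real.log ((W:ℝ)/c) = - Real.log ((c:ℝ)/W) := by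
    rw [← Real.log_inv, inv_div]
  rw [e, mul_one_div]
  generalize (c:ℝ)/W = x at *
  -- log (l/x) ≥ 1 - x/l ≥ l - x
  have h1 := Real.one_sub_inv_le_log_of_pos (div_pos hl0 hx0)
  rw [Real.log_div hl0.ne' hx0.ne', inv_div] at h1
  have h2 : l - x ≤ 1 - x / l := by
    rw [← sub_nonneg]
    have : 1 - x / l - (l - x) = (l - x) * (1 - l) / l := by field_simp
    rw [this]
    apply div_nonneg _ hl0.le
    apply mul_nonneg <;> linarith
  linarith

lemma step_sum (F : ℝ → ℝ) (hanti : AntitoneOn F (Set.Ici 0)) (W g : ℕ) (h B : ℝ) (hW : 1 ≤ W)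
    (hh0 : 0 < h) (hh1 : h < 1) (hg : (g:ℝ) ≤ h * W)
    (hh : (∫ t in (0:ℝ)..h, F t) - F 1 * h = (∫ t in (0:ℝ)..1, F t) - B) :
    B ≤ ∑ i ∈ range W, F (min (W:ℝ) (g + i) / W) / W := by
  have hW0 : (0:ℝ) < W := by exact_mod_cast hW
  have hgW' : (g:ℝ) ≤ W := by nlinarith
  have hgW : g ≤ W := by exact_mod_cast hgW'
  have H := trunc_sum (fun x => F (x / W)) W g hgW (by
    intro x hx y hy hxy
    have hx0 : 0 ≤ x := (Nat.cast_nonneg g).trans hx.1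
    apply hanti
    · exact div_nonneg hx0 hW0.le
    · exact div_nonneg (hx0.trans hxy) hW0.le
    · gcongr)
  rw [← Finset.sum_div, le_div_iff₀ hW0]
  refine le_trans ?_ H
  rw [intervalIntegral.integral_comp_div F hW0.ne', div_self hW0.ne', smul_eq_mul]
  have hx : (g:ℝ) / W ≤ h := by rwa [div_le_iff₀ hW0]
  have hx0 : 0 ≤ (g:ℝ) / W := by positivity
  have e : (g:ℝ) * F 1 = W * ((g:ℝ)/W * F 1) := by field_simp
  rw [e, ← mul_add, mul_comm B]
  gcongr
  generalize (g:ℝ)/W = x at *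
  have hii : ∀ u v : ℝ, 0 ≤ u → 0 ≤ v → IntervalIntegrable F volume u v := by
    intro u v hu hv
    apply AntitoneOn.intervalIntegrable
    apply hanti.mono
    intro z hz
    exact (le_min hu hv).trans hz.1
  have a1 := intervalIntegral.integral_add_adjacent_intervals
    (hii 0 x le_rfl hx0) (hii x 1 hx0 zero_le_one)
  have a2 := intervalIntegral.integral_add_adjacent_intervals
    (hii 0 x le_rfl hx0) (hii x h hx0 hh0.le)
  have a3 : (h - x) * F 1 ≤ ∫ t in x..h, F t := by
    have := intervalIntegral.integral_mono_on (μ := volume) hx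
      (f := fun _ => F 1) (g := F) (by simp) (hii x h hx0 hh0.le) (by
      intro t ht
      apply hanti
      · exact hx0.trans ht.1
      · exact zero_le_one (α := ℝ)
      · linarith [ht.2])
    simpa using this
  linarith

/-- Second bullet of Proposition 1: in the rate region
`ϑ⁻¹·R_alg < R_all < ϑ⁻¹·R_IT`, with a large enough coupling window `W`, the
wave of zero error propagates from the outer blocks inwards: after `k`
iterations the outermost `(k+1)·g` blocks (on both sides) have `ψ = 0`, and
after `K = 1 + ⌈Γ/(2g)⌉` iterations all blocks have `ψ = 0`. -/
theorem se_second_bullet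
    (Γ W : ℕ) (hΓ : 1 ≤ Γ) (hW : 1 ≤ W)
    (ρ₀ : Measure ℝ) [IsProbabilityMeasure ρ₀]
    (hsupp : ∃ K : Set ℝ, IsCompact K ∧ K ⊆ Set.Ioi 0 ∧ ρ₀ K = 1)
    (σ₀ : ℝ) (hσ₀ : 0 < σ₀)
    (F : ℝ → ℝ) (hF : ∀ x, F x = ∫ l, l / (l * x + σ₀ ^ 2) ∂ρ₀)
    (Rall : ℝ) (hRall : 0 < Rall)
    (ϑ : ℝ) (hϑ : ϑ = ((Γ : ℝ) + W - 1) / Γ)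
    (Wset : ℕ → Finset ℕ)
    (hWset : ∀ r, Wset r = (Finset.Icc 1 Γ).filter fun c => r + 1 ≤ c + W ∧ c ≤ r)
    (σ φ τ ψ : ℕ → ℕ → ℝ)
    (hσ0 : ∀ r ∈ Finset.Icc 1 (Γ + W - 1), σ 0 r = 1)
    (hφ : ∀ k : ℕ, ∀ r ∈ Finset.Icc 1 (Γ + W - 1), φ k r = F (σ k r))
    (hτ : ∀ k : ℕ, ∀ c ∈ Finset.Icc 1 Γ,
      τ k c = Rall * (∑ r ∈ Finset.Icc c (c + W - 1), φ k r / (ϑ * (Wset r).card))⁻¹)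
    (hψ : ∀ k : ℕ, ∀ c ∈ Finset.Icc 1 Γ, ψ k c = if 1 / 2 < τ k c then 1 else 0)
    (hσrec : ∀ k : ℕ, ∀ r ∈ Finset.Icc 1 (Γ + W - 1),
      σ (k + 1) r = ((Wset r).card : ℝ)⁻¹ * ∑ c ∈ Wset r, ψ k c)
    (Ralg : ℝ) (hRalg : Ralg = F 1 / 2)
    (RIT : ℝ) (hRIT : RIT = (1 / 2) * ∫ x in (0:ℝ)..1, F x)
    (hΓ2W : 2 * W ≤ Γ)
    (hrate1 : ϑ⁻¹ * Ralg < Rall) (hrate2 : Rall < ϑ⁻¹ * RIT)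
    (Δ : ℝ) (hΔ : Δ = ϑ⁻¹ * RIT - Rall)
    (lstar : ℝ) (hl0 : lstar ∈ Set.Ioo (0:ℝ) 1)
    (hl : lstar - Real.log lstar = ϑ * Rall / Ralg)
    (hstar : ℝ) (hh0 : hstar ∈ Set.Ioo (0:ℝ) 1)
    (hh : (∫ t in (0:ℝ)..hstar, F t) - F 1 * hstar = 2 * ϑ * Δ)
    (hWbig : max ⌈1 / lstar⌉ ⌈1 / hstar⌉ < (W : ℤ))
    (g : ℕ) (hg : g = min ⌊hstar * W⌋₊ ⌊lstar * W⌋₊) :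
    (∀ k : ℕ, ∀ c : ℕ, 1 ≤ c → c ≤ min ((k + 1) * g) ⌈(Γ : ℝ) / 2⌉₊ →
      ψ k c = 0 ∧ ψ k (Γ - c + 1) = 0) ∧
    (∀ c ∈ Finset.Icc 1 Γ, ψ (1 + ⌈(Γ : ℝ) / (2 * g)⌉₊) c = 0) := by
  classical
  obtain ⟨hFnn, hscale⟩ := F_scale ρ₀ hsupp σ₀ hσ₀ F hF
  have hanti : AntitoneOn F (Set.Ici 0) := by
    intro x hx y hy hxy
    have := hscale x y 1 1 hx hxy one_pos le_rfl
    simpa using this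
  have hW0 : (0:ℝ) < W := by exact_mod_cast hW
  have hΓ0 : (0:ℝ) < Γ := by exact_mod_cast hΓ
  have hϑ0 : 0 < ϑ := by
    rw [hϑ]
    apply div_pos _ hΓ0
    have : (1:ℝ) ≤ W := by exact_mod_cast hW
    linarith
  obtain ⟨hl0, hl1⟩ := hl0
  obtain ⟨hh0, hh1⟩ := hh0
  have hRne : Ralg ≠ 0 := by
    intro h
    rw [h, div_zero] at hl
    have := Real.log_neg hl0 hl1
    linarith
  have hbase : F 1 * (lstar - Real.log lstar) = 2 * (ϑ * Rall) := by
    rw [hl, show F 1 = 2 * Ralg by rw [hRalg]; ring]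
    field_simp
  have hh' : (∫ t in (0:ℝ)..hstar, F t) - F 1 * hstar
      = (∫ t in (0:ℝ)..1, F t) - 2 * (ϑ * Rall) := by
    rw [hh, hΔ, hRIT]
    field_simp
  have hgh : (g:ℝ) ≤ hstar * W := by
    have : g ≤ ⌊hstar * W⌋₊ := by omega
    exact (Nat.le_floor_iff (by positivity)).1 this
  have hgl : (g:ℝ) ≤ lstar * W := by
    have : g ≤ ⌊lstar * W⌋₊ := by omega
    exact (Nat.le_floor_iff (by positivity)).1 this
  have hg1 : 1 ≤ g := by
    obtain ⟨q1, q2⟩ := max_lt_iff.1 hWbig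
    have q1' : 1 / lstar ≤ W := (Int.le_ceil _).trans (by exact_mod_cast q1.le)
    have q2' : 1 / hstar ≤ W := (Int.le_ceil _).trans (by exact_mod_cast q2.le)
    rw [div_le_iff₀ (by assumption)] at q1' q2'
    rw [hg]
    apply le_min
    · apply Nat.le_floor; push_cast; linarith
    · apply Nat.le_floor; push_cast; linarith
  -- cardinalities
  have hsub1 : ∀ r, Wset r ⊆ Finset.Icc 1 r := by
    intro r c hc
    rw [hWset] at hc
    simp only [Finset.mem_filter, Finset.mem_Icc] at hc ⊢
    omega
  have hsubΓ : ∀ r, Wset r ⊆ Finset.Icc 1 Γ := by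
    intro r c hc
    rw [hWset] at hc
    exact (Finset.mem_filter.1 hc).1
  have hcard1 : ∀ r, (Wset r).card ≤ r := by
    intro r
    simpa using Finset.card_le_card (hsub1 r)
  have hcardW : ∀ r, (Wset r).card ≤ W := by
    intro r
    have : Wset r ⊆ Finset.Icc (r + 1 - W) r := by
      intro c hc
      rw [hWset] at hc
      simp only [Finset.mem_filter, Finset.mem_Icc] at hc ⊢
      omega
    have := Finset.card_le_card this
    simp only [Nat.card_Icc] at this
    omega
  have hcard2 : ∀ r, (Wset r).card ≤ Γ + W - r := by
    intro r
    have : Wset r ⊆ Finset.Icc (r + 1 - W) Γ ∩ Finset.Icc 1 Γ := by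
      intro c hc
      rw [hWset] at hc
      simp only [Finset.mem_filter, Finset.mem_Icc, Finset.mem_inter] at hc ⊢
      omega
    have := Finset.card_le_card (this.trans Finset.inter_subset_left)
    have h3 := Finset.card_le_card (hsubΓ r)
    simp only [Nat.card_Icc] at this h3
    omega
  have hcardpos : ∀ r, 1 ≤ r → r ≤ Γ + W - 1 → 1 ≤ (Wset r).card := by
    intro r h1 h2
    apply Finset.card_pos.2
    refine ⟨min r Γ, ?_⟩
    rw [hWset]
    simp only [Finset.mem_filter, Finset.mem_Icc]
    omega
  -- criterion
  have hcrit : ∀ k c, 1 ≤ c → c ≤ Γ →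
      2 * (ϑ * Rall) ≤ ∑ i ∈ range W, F (σ k (c + i)) / (Wset (c + i)).card → ψ k c = 0 := by
    intro k c h1 h2 hS
    have hc : c ∈ Finset.Icc 1 Γ := Finset.mem_Icc.2 ⟨h1, h2⟩
    rw [hψ k c hc, if_neg]
    rw [not_lt, hτ k c hc]
    have e : ∑ r ∈ Finset.Icc c (c + W - 1), φ k r / (ϑ * (Wset r).card)
        = (∑ i ∈ range W, F (σ k (c + i)) / (Wset (c + i)).card) / ϑ := by
      have : Finset.Icc c (c + W - 1) = Finset.Ico c (c + W) := by
        ext x; simp only [Finset.mem_Icc, Finset.mem_Ico]; omega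
      rw [this, Finset.sum_Ico_eq_sum_range, Finset.sum_div]
      simp only [Nat.add_sub_cancel_left]
      apply Finset.sum_congr rfl
      intro i hi
      have := Finset.mem_range.1 hi
      rw [hφ k (c + i) (Finset.mem_Icc.2 ⟨by omega, by omega⟩), div_div, mul_comm ϑ]
    rw [e]
    have hS' : 2 * Rall ≤ (∑ i ∈ range W, F (σ k (c + i)) / (Wset (c + i)).card) / ϑ := by
      rw [le_div_iff₀ hϑ0]; linarith
    generalize (∑ i ∈ range W, F (σ k (c + i)) / (Wset (c + i)).card) / ϑ = S at hS'
    have hS0 : 0 < S := by linarith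
    rw [← div_eq_mul_inv, div_le_iff₀ hS0]
    linarith
  -- reflected criterion
  have hcrit2 : ∀ k c, 1 ≤ c → c ≤ Γ →
      2 * (ϑ * Rall) ≤ ∑ i ∈ range W, F (σ k (Γ + W - (c + i))) / (Wset (Γ + W - (c + i))).card →
      ψ k (Γ - c + 1) = 0 := by
    intro k c h1 h2 hS
    apply hcrit k (Γ - c + 1) (by omega) (by omega)
    rw [← Finset.sum_range_reflect]
    refine hS.trans (le_of_eq ?_)
    apply Finset.sum_congr rfl
    intro i hi
    have := Finset.mem_range.1 hi
    rw [show Γ - c + 1 + (W - 1 - i) = Γ + W - (c + i) by omega]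
  -- abstract base and step
  have hB : ∀ c, 1 ≤ c → c ≤ g → ∀ n : ℕ → ℕ, (∀ i < W, 1 ≤ n i ∧ n i ≤ W ∧ n i ≤ c + i) →
      2 * (ϑ * Rall) ≤ ∑ i ∈ range W, F 1 / (n i) := by
    intro c h1 h2 n hn
    have h2' : (c:ℝ) ≤ g := by exact_mod_cast h2
    have := base_sum W c lstar h1 hl1 (h2'.trans hgl)
    rw [← hbase]
    refine (mul_le_mul_of_nonneg_left this (hFnn 1 zero_le_one)).trans ?_
    rw [Finset.mul_sum]
    apply Finset.sum_le_sum
    intro i hi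
    obtain ⟨b1, b2, b3⟩ := hn i (Finset.mem_range.1 hi)
    rw [mul_one_div]
    have : (0:ℝ) < n i := by exact_mod_cast b1
    apply div_le_div_of_nonneg_left (hFnn 1 zero_le_one) this
    apply le_min
    · exact_mod_cast b2
    · exact_mod_cast b3
  have hSt : ∀ (n : ℕ → ℕ) (N : ℕ → ℝ),
      (∀ i < W, 1 ≤ n i ∧ n i ≤ W ∧ 0 ≤ N i ∧ N i ≤ n i ∧ N i ≤ g + i) →
      2 * (ϑ * Rall) ≤ ∑ i ∈ range W, F ((n i : ℝ)⁻¹ * N i) / (n i) := by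
    intro n N hn
    refine (step_sum F hanti W g hstar _ hW hh0 hh1 hgh hh').trans ?_
    apply Finset.sum_le_sum
    intro i hi
    obtain ⟨b1, b2, b3, b4, b5⟩ := hn i (Finset.mem_range.1 hi)
    have b1' : (0:ℝ) < n i := by exact_mod_cast b1
    have b2' : (n i:ℝ) ≤ W := by exact_mod_cast b2
    rw [inv_mul_eq_div]
    exact hscale _ _ _ _ b3 (le_min (b4.trans b2') b5) b1' b2'
  have hψ01 : ∀ k c, c ∈ Finset.Icc 1 Γ → 0 ≤ ψ k c ∧ ψ k c ≤ 1 := by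
    intro k c hc
    rw [hψ k c hc]
    split_ifs <;> norm_num
  have hN0 : ∀ k r, 0 ≤ ∑ c ∈ Wset r, ψ k c := fun k r =>
    Finset.sum_nonneg fun c hc => (hψ01 k c (hsubΓ r hc)).1
  have hNn : ∀ k r, ∑ c ∈ Wset r, ψ k c ≤ (Wset r).card := by
    intro k r
    have := Finset.sum_le_sum fun c hc => (hψ01 k c (hsubΓ r hc)).2
    simpa using this
  have hNT : ∀ k r (T : Finset ℕ), (∀ c ∈ Wset r, c ∉ T → ψ k c = 0) →
      ∑ c ∈ Wset r, ψ k c ≤ T.card := by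
    intro k r T hT
    have : ∑ c ∈ Wset r, ψ k c ≤ ∑ c ∈ Wset r, if c ∈ T then (1:ℝ) else 0 := by
      apply Finset.sum_le_sum
      intro c hc
      split_ifs with h
      · exact (hψ01 k c (hsubΓ r hc)).2
      · exact (hT c hc h).le
    refine this.trans ?_
    rw [Finset.sum_ite_mem]
    simp only [Finset.sum_const, nsmul_eq_mul, mul_one]
    exact_mod_cast Finset.card_le_card Finset.inter_subset_right
  have main : ∀ k c, 1 ≤ c → c ≤ Γ → c ≤ (k + 1) * g → ψ k c = 0 ∧ ψ k (Γ - c + 1) = 0 := by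
    intro k
    induction k with
    | zero =>
      intro c h1 h2 h3
      rw [zero_add, one_mul] at h3
      constructor
      · apply hcrit 0 c h1 h2
        refine (hB c h1 h3 (fun i => (Wset (c + i)).card) ?_).trans (le_of_eq ?_)
        · intro i hi
          exact ⟨hcardpos _ (by omega) (by omega), hcardW _, hcard1 _⟩
        · apply Finset.sum_congr rfl
          intro i hi
          have := Finset.mem_range.1 hi
          rw [hσ0 _ (Finset.mem_Icc.2 ⟨by omega, by omega⟩)]
      · apply hcrit2 0 c h1 h2
        refine (hB c h1 h3 (fun i => (Wset (Γ + W - (c + i))).card) ?_).trans (le_of_eq ?_)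
        · intro i hi
          refine ⟨hcardpos _ (by omega) (by omega), hcardW _, ?_⟩
          have := hcard2 (Γ + W - (c + i))
          show (Wset (Γ + W - (c + i))).card ≤ c + i
          omega
        · apply Finset.sum_congr rfl
          intro i hi
          have := Finset.mem_range.1 hi
          rw [hσ0 _ (Finset.mem_Icc.2 ⟨by omega, by omega⟩)]
    | succ k ih =>
      intro c h1 h2 h3
      have h3' : c ≤ (k + 1) * g + g := by
        have : (k + 1 + 1) * g = (k + 1) * g + g := by ring
        omega
      generalize (k + 1) * g = m at *
      constructor
      · apply hcrit (k + 1) c h1 h2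
        refine (hSt (fun i => (Wset (c + i)).card)
          (fun i => ∑ c ∈ Wset (c + i), ψ k c) ?_).trans (le_of_eq ?_)
        · intro i hi
          refine ⟨hcardpos _ (by omega) (by omega), hcardW _, hN0 _ _, hNn _ _, ?_⟩
          refine (hNT k (c + i) (Finset.Icc (m + 1) (c + i)) ?_).trans ?_
          · intro d hd hdT
            have d1 := Finset.mem_Icc.1 (hsub1 _ hd)
            have d2 := Finset.mem_Icc.1 (hsubΓ _ hd)
            rw [Finset.mem_Icc] at hdT
            exact (ih d (by omega) (by omega) (by omega)).1
          · rw [Nat.card_Icc]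
            exact_mod_cast (by omega : c + i + 1 - (m + 1) ≤ g + i)
        · apply Finset.sum_congr rfl
          intro i hi
          have := Finset.mem_range.1 hi
          rw [hσrec k _ (Finset.mem_Icc.2 ⟨by omega, by omega⟩)]
      · apply hcrit2 (k + 1) c h1 h2
        refine (hSt (fun i => (Wset (Γ + W - (c + i))).card)
          (fun i => ∑ c ∈ Wset (Γ + W - (c + i)), ψ k c) ?_).trans (le_of_eq ?_)
        · intro i hi
          refine ⟨hcardpos _ (by omega) (by omega), hcardW _, hN0 _ _, hNn _ _, ?_⟩
          refine (hNT k _ ((Finset.Icc 1 (Γ - m)).filter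
            (fun d => Γ + 1 ≤ d + (c + i))) ?_).trans ?_
          · intro d hd hdT
            have d2 := Finset.mem_Icc.1 (hsubΓ _ hd)
            rw [hWset, Finset.mem_filter] at hd
            rw [Finset.mem_filter, Finset.mem_Icc] at hdT
            have := (ih (Γ - d + 1) (by omega) (by omega) (by omega)).2
            rwa [show Γ - (Γ - d + 1) + 1 = d by omega] at this
          · have hss : (Finset.Icc 1 (Γ - m)).filter (fun d => Γ + 1 ≤ d + (c + i))
                ⊆ Finset.Ioc (Γ - (m + (g + i))) (Γ - m) := by
              intro d hd
              rw [Finset.mem_filter, Finset.mem_Icc] at hd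
              rw [Finset.mem_Ioc]
              omega
            have := Finset.card_le_card hss
            rw [Nat.card_Ioc] at this
            exact_mod_cast (by omega : _ ≤ g + i)
        · apply Finset.sum_congr rfl
          intro i hi
          have := Finset.mem_range.1 hi
          rw [hσrec k _ (Finset.mem_Icc.2 ⟨by omega, by omega⟩)]
  constructor
  · intro k c h1 h2
    obtain ⟨h3, h4⟩ := le_min_iff.1 h2
    refine main k c h1 (h4.trans ?_) h3
    apply Nat.ceil_le.2
    linarith
  · intro c hc
    obtain ⟨c1, c2⟩ := Finset.mem_Icc.1 hc
    have hg0 : (0:ℝ) < g := by exact_mod_cast hg1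
    have hK : (Γ:ℝ) / (2 * g) ≤ ⌈(Γ : ℝ) / (2 * g)⌉₊ := Nat.le_ceil _
    generalize ⌈(Γ : ℝ) / (2 * g)⌉₊ = K at *
    rw [div_le_iff₀ (by positivity)] at hK
    have hK' : Γ ≤ K * (2 * g) := by exact_mod_cast hK
    have e : (1 + K + 1) * g = K * g + 2 * g := by ring
    have e2 : K * (2 * g) = 2 * (K * g) := by ring
    by_cases hcase : c ≤ (1 + K + 1) * g
    · exact (main (1 + K) c c1 c2 hcase).1
    · have := (main (1 + K) (Γ - c + 1) (by omega) (by omega) (by omega)).2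
      rwa [show Γ - (Γ - c + 1) + 1 = c by omega] at this
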